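/- Let L = L₀ ⊕ L₁ be a nilpotent complex Leibniz superalgebra with dim L₀ = n ≥ 3 and dim L₁ = m, generated by two elements x₁ ∈ L₀ and y₁ ∈ L₁, and possessing a basis y₁, y₂, …, y_m of L₁ with [y_j, x₁] = y_{j+1} for 1 ≤ j ≤ m−1 and [y_m, x₁] = 0. Assume that for every x ∈ L₀ \ L₀² the restriction of R_x to L₀ satisfies (R_x|_{L₀})^{n−2} = 0 (i.e. n₁ ≤ n−2 in the characteristic sequence), and that dim L₀³ = n − 3 (where L₀^k denotes the descending central series of the Leibniz algebra L₀). Then the nilindex of L is less than n + m; equivalently, L^{n+m−1} = 0. -/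

import Mathlib

/-- A complex Leibniz superalgebra structure on a vector space `V`:
a bilinear bracket together with an internal ℤ₂-grading `V = L0 ⊕ L1`
such that the bracket respects the grading and the Leibniz superidentity
`[x,[y,z]] = [[x,y],z] − (−1)^{αβ}[[x,z],y]` holds for homogeneous `y, z`. -/
structure LeibnizSuperAlg (V : Type*) [AddCommGroup V] [Module ℂ V] where
  br : V →ₗ[ℂ] V →ₗ[ℂ] V
  L0 : Submodule ℂ V
  L1 : Submodule ℂ V
  compl : IsCompl L0 L1
  grade00 : ∀ x ∈ L0, ∀ y ∈ L0, br x y ∈ L0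
  grade01 : ∀ x ∈ L0, ∀ y ∈ L1, br x y ∈ L1
  grade10 : ∀ x ∈ L1, ∀ y ∈ L0, br x y ∈ L1
  grade11 : ∀ x ∈ L1, ∀ y ∈ L1, br x y ∈ L0
  super_ee : ∀ (x : V), ∀ y ∈ L0, ∀ z ∈ L0,
    br x (br y z) = br (br x y) z - br (br x z) y
  super_eo : ∀ (x : V), ∀ y ∈ L0, ∀ z ∈ L1,
    br x (br y z) = br (br x y) z - br (br x z) y
  super_oe : ∀ (x : V), ∀ y ∈ L1, ∀ z ∈ L0,
    br x (br y z) = br (br x y) z - br (br x z) y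
  super_oo : ∀ (x : V), ∀ y ∈ L1, ∀ z ∈ L1,
    br x (br y z) = br (br x y) z + br (br x z) y

namespace LeibnizSuperAlg

variable {V : Type*} [AddCommGroup V] [Module ℂ V]

/-- The span of all products `[u,v]` with `u ∈ S`, `v ∈ T`. -/
def prodSpan (A : LeibnizSuperAlg V) (S T : Submodule ℂ V) : Submodule ℂ V :=
  Submodule.span ℂ {z : V | ∃ u ∈ S, ∃ v ∈ T, z = A.br u v}

/-- `A.lcs k` is the `(k+1)`-st term `L^{k+1}` of the descending central series:
`L¹ = L`, `L^{k+1} = [L^k, L]`. -/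
def lcs (A : LeibnizSuperAlg V) : ℕ → Submodule ℂ V
  | 0 => ⊤
  | k + 1 => A.prodSpan (lcs A k) ⊤

/-- `A.lcs0 k` is the `(k+1)`-st term `L₀^{k+1}` of the descending central series
of the even part: `L₀¹ = L₀`, `L₀^{k+1} = [L₀^k, L₀]`. -/
def lcs0 (A : LeibnizSuperAlg V) : ℕ → Submodule ℂ V
  | 0 => A.L0
  | k + 1 => A.prodSpan (lcs0 A k) A.L0

/-- Nilpotency: some term of the descending central series vanishes. -/
def IsNilpotent (A : LeibnizSuperAlg V) : Prop := ∃ s, A.lcs s = ⊥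

/-- `S` generates `L`: the smallest subspace containing `S` and closed under the
product is `L` itself. -/
def Generates (A : LeibnizSuperAlg V) (S : Set V) : Prop :=
  ∀ W : Submodule ℂ V, S ⊆ W → (∀ u ∈ W, ∀ v ∈ W, A.br u v ∈ W) → W = ⊤

/-- The operator of right multiplication `R_x : z ↦ [z, x]`. -/
def R (A : LeibnizSuperAlg V) (x : V) : V →ₗ[ℂ] V := A.br.flip x

end LeibnizSuperAlg

namespace LeibnizSuperAlg

section Aux

variable {V : Type*} [AddCommGroup V] [Module ℂ V] (A : LeibnizSuperAlg V)

theorem R_apply (x a : V) : A.R x a = A.br a x := rfl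

theorem br_mem_lcs_succ {k : ℕ} {a : V} (ha : a ∈ A.lcs k) (b : V) :
    A.br a b ∈ A.lcs (k + 1) :=
  Submodule.subset_span ⟨a, ha, b, Submodule.mem_top, rfl⟩

theorem lcs_succ_le (k : ℕ) : A.lcs (k + 1) ≤ A.lcs k := by
  induction k with
  | zero => exact le_top
  | succ k ih =>
    refine Submodule.span_le.2 ?_
    rintro z ⟨u, hu, v, -, rfl⟩
    exact A.br_mem_lcs_succ (ih hu) v

theorem lcs_anti : Antitone A.lcs := antitone_nat_of_succ_le A.lcs_succ_le

theorem exists_proj : ∃ P : V →ₗ[ℂ] V, (∀ a, P a ∈ A.L0) ∧ (∀ a, a - P a ∈ A.L1) ∧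
    (∀ a ∈ A.L0, P a = a) ∧ (∀ a ∈ A.L1, P a = 0) ∧
    (∀ k, ∀ a ∈ A.lcs k, P a ∈ A.lcs k) := by
  have key : ∃ P : V →ₗ[ℂ] V, (∀ a, P a ∈ A.L0) ∧ (∀ a, a - P a ∈ A.L1) ∧
    (∀ a ∈ A.L0, P a = a) ∧ (∀ a ∈ A.L1, P a = 0) := by
    refine ⟨A.L0.subtype ∘ₗ Submodule.projectionOnto A.L0 A.L1 A.compl, ?_, ?_, ?_, ?_⟩
    · intro a; simp
    · intro a
      obtain ⟨u, hu, v, hv, rfl⟩ := Submodule.mem_sup.1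
        (show a ∈ A.L0 ⊔ A.L1 by rw [A.compl.sup_eq_top]; trivial)
      have h1 := Submodule.projectionOnto_apply_left A.compl ⟨u, hu⟩
      have h2 := Submodule.projectionOnto_apply_right A.compl ⟨v, hv⟩
      simp only at h1 h2
      simp [h1, h2, hv]
    · intro a ha
      have h1 := Submodule.projectionOnto_apply_left A.compl ⟨a, ha⟩
      simp only at h1
      simp [h1]
    · intro a ha
      have h2 := Submodule.projectionOnto_apply_right A.compl ⟨a, ha⟩
      simp only at h2
      simp [h2]
  obtain ⟨P, h0, h1, h2, h3⟩ := key
  refine ⟨P, h0, h1, h2, h3, ?_⟩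
  intro k
  induction k with
  | zero => intro a _; exact Submodule.mem_top
  | succ k ih =>
    intro a ha
    have : A.lcs (k + 1) ≤ (A.lcs (k + 1)).comap P := by
      refine Submodule.span_le.2 ?_
      rintro z ⟨u, hu, v, -, rfl⟩
      have e : P (A.br u v) = A.br (P u) (P v) + A.br (u - P u) (v - P v) := by
        have : A.br u v = A.br (P u) (P v) + A.br (u - P u) (v - P v)
          + (A.br (P u) (v - P v) + A.br (u - P u) (P v)) := by
          simp only [map_sub, LinearMap.sub_apply]; abel
        rw [this, map_add P, h3 _ (A.L1.add_mem (A.grade01 _ (h0 u) _ (h1 v))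
          (A.grade10 _ (h1 u) _ (h0 v))), add_zero]
        exact h2 _ (A.L0.add_mem (A.grade00 _ (h0 u) _ (h0 v)) (A.grade11 _ (h1 u) _ (h1 v)))
      show P (A.br u v) ∈ A.lcs (k + 1)
      rw [e]
      exact Submodule.add_mem _ (A.br_mem_lcs_succ (ih u hu) _)
        (A.br_mem_lcs_succ (Submodule.sub_mem _ hu (ih u hu)) _)
    exact this ha

theorem br_mem (j : ℕ) : ∀ i : ℕ, ∀ a ∈ A.lcs i, ∀ b ∈ A.lcs j,
    A.br a b ∈ A.lcs (i + j + 1) := by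
  obtain ⟨P, h0, h1, h2, h3, hP⟩ := A.exists_proj
  induction j with
  | zero => intro i a ha b _; exact A.br_mem_lcs_succ ha b
  | succ j ih =>
    intro i a ha b hb
    have : A.lcs (j + 1) ≤ (A.lcs (i + (j + 1) + 1)).comap (A.br a) := by
      refine Submodule.span_le.2 ?_
      rintro z ⟨u, hu, v, -, rfl⟩
      show A.br a (A.br u v) ∈ A.lcs (i + (j + 1) + 1)
      have k1 : ∀ u ∈ A.lcs j, ∀ v, A.br (A.br a u) v ∈ A.lcs (i + (j + 1) + 1) := fun u hu v =>
        A.br_mem_lcs_succ (ih i a ha u hu) v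
      have k2 : ∀ u ∈ A.lcs j, ∀ v, A.br (A.br a v) u ∈ A.lcs (i + (j + 1) + 1) := by
        intro u hu v
        have := ih (i + 1) _ (A.br_mem_lcs_succ ha v) u hu
        have e : i + 1 + j + 1 = i + (j + 1) + 1 := by omega
        rwa [e] at this
      have e : A.br a (A.br u v) = A.br a (A.br (P u) (P v)) + A.br a (A.br (P u) (v - P v))
          + A.br a (A.br (u - P u) (P v)) + A.br a (A.br (u - P u) (v - P v)) := by
        simp only [map_sub, LinearMap.sub_apply]; abel
      have hu0 := hP j u hu
      have hu1 := Submodule.sub_mem _ hu hu0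
      rw [e, A.super_ee _ _ (h0 u) _ (h0 v), A.super_eo _ _ (h0 u) _ (h1 v),
        A.super_oe _ _ (h1 u) _ (h0 v), A.super_oo _ _ (h1 u) _ (h1 v)]
      refine Submodule.add_mem _ (Submodule.add_mem _ (Submodule.add_mem _ ?_ ?_) ?_) ?_
      · exact Submodule.sub_mem _ (k1 _ hu0 _) (k2 _ hu0 _)
      · exact Submodule.sub_mem _ (k1 _ hu0 _) (k2 _ hu0 _)
      · exact Submodule.sub_mem _ (k1 _ hu1 _) (k2 _ hu1 _)
      · exact Submodule.add_mem _ (k1 _ hu1 _) (k2 _ hu1 _)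
    exact this hb

/-- Variant with a free target index. -/
theorem br_mem' {i j k : ℕ} (h : k ≤ i + j + 1) {a b : V} (ha : a ∈ A.lcs i)
    (hb : b ∈ A.lcs j) : A.br a b ∈ A.lcs k :=
  A.lcs_anti h (A.br_mem j i a ha b hb)

theorem gen_top {x y : V} (hgen : A.Generates {x, y}) :
    Submodule.span ℂ {x, y} ⊔ A.lcs 1 = ⊤ := by
  apply hgen
  · intro a ha
    exact Submodule.mem_sup_left (Submodule.subset_span ha)
  · intro u _ v _
    exact Submodule.mem_sup_right (A.br_mem_lcs_succ (k := 0) Submodule.mem_top v)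

theorem gen_step {x y : V} (hgen : A.Generates {x, y}) {k : ℕ} (G : Set V) (S : Submodule ℂ V)
    (hF : A.lcs k ≤ Submodule.span ℂ G ⊔ A.lcs (k + 1)) (hS : A.lcs (k + 2) ≤ S)
    (hx : ∀ a ∈ G, A.br a x ∈ S) (hy : ∀ a ∈ G, A.br a y ∈ S) : A.lcs (k + 1) ≤ S := by
  have aux : ∀ w : V, (∀ a ∈ G, A.br a w ∈ S) → ∀ u ∈ A.lcs k, A.br u w ∈ S := by
    intro w hw u hu
    have h1 : Submodule.span ℂ G ⊔ A.lcs (k + 1) ≤ S.comap (A.R w) := by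
      refine sup_le (Submodule.span_le.2 hw) ?_
      intro a ha
      exact hS (A.br_mem_lcs_succ ha w)
    exact h1 (hF hu)
  refine Submodule.span_le.2 ?_
  rintro z ⟨u, hu, v, -, rfl⟩
  have h2 : Submodule.span ℂ {x, y} ⊔ A.lcs 1 ≤ S.comap (A.br u) := by
    refine sup_le (Submodule.span_le.2 ?_) ?_
    · rintro a (rfl | rfl)
      · exact aux _ hx u hu
      · exact aux _ hy u hu
    · intro a ha
      exact hS (A.br_mem' (by omega) hu ha)
  rw [A.gen_top hgen] at h2
  exact h2 Submodule.mem_top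

theorem descend (hnil : A.IsNilpotent) (S W : Submodule ℂ V) (hW : W ≤ S) (k₀ : ℕ)
    (h : ∀ k, k₀ ≤ k → ∀ a ∈ A.lcs k, a ∈ S → a ∈ W ⊔ A.lcs (k + 1)) :
    ∀ a ∈ A.lcs k₀, a ∈ S → a ∈ W := by
  obtain ⟨s, hs⟩ := hnil
  have key : ∀ d k, k₀ ≤ k → s ≤ k + d → ∀ a ∈ A.lcs k, a ∈ S → a ∈ W := by
    intro d
    induction d with
    | zero =>
      intro k _ hk a ha _
      have := A.lcs_anti (show s ≤ k by omega) ha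
      rw [hs, Submodule.mem_bot] at this
      rw [this]; exact W.zero_mem
    | succ d ih =>
      intro k hk0 hk a ha haS
      obtain ⟨w, hw, b, hb, rfl⟩ := Submodule.mem_sup.1 (h k hk0 a ha haS)
      refine W.add_mem hw (ih (k + 1) (by omega) (by omega) b hb ?_)
      have := S.sub_mem haS (hW hw)
      simpa using this
  exact key s k₀ le_rfl (by omega)

/-- If `L₀` is spanned by `x` and a `T`-orbit of `e` with `T^r e = 0`, then `dim L₀ ≤ r+1`. -/
theorem finrank_orbit [FiniteDimensional ℂ V] (S : Submodule ℂ V) (x e : V) (T : V →ₗ[ℂ] V)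
    (r : ℕ) (hT : (T ^ r) e = 0)
    (hS : S ≤ Submodule.span ℂ {x} ⊔ Submodule.span ℂ (Set.range fun j : ℕ => (T ^ j) e)) :
    Module.finrank ℂ S ≤ r + 1 := by
  classical
  let G : Finset V := insert x ((Finset.range r).image fun j => (T ^ j) e)
  have hG : S ≤ Submodule.span ℂ (G : Set V) := by
    refine hS.trans (sup_le ?_ ?_)
    · refine Submodule.span_mono ?_
      intro a ha
      simp only [Set.mem_singleton_iff] at ha
      simp [G, ha]
    · refine Submodule.span_le.2 ?_
      rintro _ ⟨j, rfl⟩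
      by_cases hj : j < r
      · refine Submodule.subset_span ?_
        simp only [G, Finset.coe_insert, Finset.coe_image, Finset.coe_range]
        exact Or.inr ⟨j, hj, rfl⟩
      · have : (T ^ j) e = 0 := by
          obtain ⟨d, rfl⟩ := Nat.exists_eq_add_of_le (not_lt.1 hj)
          rw [add_comm, pow_add, Module.End.mul_apply, hT, map_zero]
        simp only [this]
        exact Submodule.zero_mem _
  calc Module.finrank ℂ S ≤ Module.finrank ℂ (Submodule.span ℂ (G : Set V)) :=
        Submodule.finrank_mono hG
    _ ≤ G.card := finrank_span_finset_le_card G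
    _ ≤ _ := by
        refine (Finset.card_insert_le _ _).trans ?_
        have := Finset.card_image_le (s := Finset.range r) (f := fun j => (T ^ j) e)
        simp only [Finset.card_range] at this
        omega

theorem lcs0_one_le {k : ℕ} (h : A.L0 ≤ A.lcs k) : A.lcs0 1 ≤ A.lcs (k + k + 1) := by
  refine Submodule.span_le.2 ?_
  rintro z ⟨u, hu, v, hv, rfl⟩
  exact A.br_mem k k u (h hu) v (h hv)

/-- Right multiplication by `[y,y]` for odd `y`. -/
theorem br_sq {y : V} (hy : y ∈ A.L1) (a : V) :
    A.br a (A.br y y) = (2 : ℂ) • A.br (A.br a y) y := by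
  rw [A.super_oo a y hy y hy, two_smul]

theorem br_sq_even {x : V} (hx : x ∈ A.L0) (a : V) : A.br a (A.br x x) = 0 := by
  rw [A.super_ee a x hx x hx, sub_self]

theorem Rpow_succ (x a : V) (k : ℕ) : (A.R x ^ (k + 1)) a = A.br ((A.R x ^ k) a) x := by
  rw [pow_succ', Module.End.mul_apply, R_apply]

theorem Rpow_mem (x a : V) {i : ℕ} (ha : a ∈ A.lcs i) (k : ℕ) : (A.R x ^ k) a ∈ A.lcs (i + k) := by
  induction k with
  | zero => simpa using ha
  | succ k ih => rw [Rpow_succ]; exact A.br_mem_lcs_succ ih x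

theorem Rpow_even {x : V} (hx : x ∈ A.L0) {a : V} (ha : a ∈ A.L0) (k : ℕ) :
    (A.R x ^ k) a ∈ A.L0 := by
  induction k with
  | zero => simpa using ha
  | succ k ih => rw [Rpow_succ]; exact A.grade00 _ ih _ hx

theorem Rpow_odd {x : V} (hx : x ∈ A.L0) {a : V} (ha : a ∈ A.L1) (k : ℕ) :
    (A.R x ^ k) a ∈ A.L1 := by
  induction k with
  | zero => simpa using ha
  | succ k ih => rw [Rpow_succ]; exact A.grade10 _ ih _ hx

theorem Rpow_parity {y : V} (hy : y ∈ A.L1) {a : V} (ha : a ∈ A.L0) (k : ℕ) :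
    (A.R y ^ (2 * k)) a ∈ A.L0 ∧ (A.R y ^ (2 * k + 1)) a ∈ A.L1 := by
  have aux : ∀ k, (A.R y ^ (2 * k)) a ∈ A.L0 → (A.R y ^ (2 * k + 1)) a ∈ A.L1 := by
    intro k h; rw [Rpow_succ]; exact A.grade01 _ h _ hy
  have : (A.R y ^ (2 * k)) a ∈ A.L0 := by
    induction k with
    | zero => simpa using ha
    | succ k ih =>
      rw [show 2 * (k + 1) = 2 * k + 1 + 1 by ring, Rpow_succ]
      exact A.grade11 _ (aux k ih) _ hy
  exact ⟨this, aux k this⟩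

/-- An even element of `ℂ o + F` with `o` odd and `F = lcs k` lies in `F`. -/
theorem even_mem {k : ℕ} {o a : V} (ho : o ∈ A.L1) (ha : a ∈ A.L0)
    (h : a ∈ Submodule.span ℂ {o} ⊔ A.lcs k) : a ∈ A.lcs k := by
  obtain ⟨P, h0, h1, h2, h3, hP⟩ := A.exists_proj
  obtain ⟨u, hu, b, hb, rfl⟩ := Submodule.mem_sup.1 h
  obtain ⟨c, rfl⟩ := Submodule.mem_span_singleton.1 hu
  rw [← h2 _ ha, map_add, map_smul, h3 _ ho, smul_zero, zero_add]
  exact hP k b hb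

theorem odd_mem {k : ℕ} {o a : V} (ho : o ∈ A.L0) (ha : a ∈ A.L1)
    (h : a ∈ Submodule.span ℂ {o} ⊔ A.lcs k) : a ∈ A.lcs k := by
  obtain ⟨P, h0, h1, h2, h3, hP⟩ := A.exists_proj
  obtain ⟨u, hu, b, hb, hab⟩ := Submodule.mem_sup.1 h
  obtain ⟨c, rfl⟩ := Submodule.mem_span_singleton.1 hu
  have e : a = b - P b := by
    have := h3 _ ha
    rw [← hab, map_add, map_smul, h2 _ ho] at this
    rw [← hab, eq_sub_iff_add_eq]
    calc c • o + b + P b = (c • o + P b) + b := by abel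
      _ = b := by rw [this, zero_add]
  rw [e]
  exact Submodule.sub_mem _ hb (hP k b hb)

/-- `y ∉ L²`. -/
theorem y_notin (hnil : A.IsNilpotent) {x y : V} (hx : x ∈ A.L0) (hy : y ∈ A.L1) (hy0 : y ≠ 0)
    (hgen : A.Generates {x, y}) : y ∉ A.lcs 1 := by
  intro hy1
  have key : ∀ k, A.lcs k ≤ Submodule.span ℂ {(A.R x ^ k) x} ⊔ A.lcs (k + 1) := by
    intro k
    induction k with
    | zero =>
      show ⊤ ≤ _
      rw [← A.gen_top hgen]
      refine sup_le (Submodule.span_le.2 ?_) le_sup_right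
      rintro a (rfl | rfl)
      · exact Submodule.mem_sup_left (Submodule.subset_span (by simp))
      · exact Submodule.mem_sup_right hy1
    | succ k ih =>
      refine A.gen_step hgen _ _ ih le_sup_right ?_ ?_
      · rintro a rfl
        exact Submodule.mem_sup_left (Submodule.subset_span (by simp [Rpow_succ]))
      · rintro a rfl
        refine Submodule.mem_sup_right ?_
        exact A.br_mem' (i := k) (j := 1) (by omega)
          (by simpa using A.Rpow_mem x x (i := 0) Submodule.mem_top k) hy1
  have h := A.descend hnil ⊤ A.L0 le_top 0 (fun k _ a ha _ => by
    refine (sup_le ?_ le_sup_right : Submodule.span ℂ {(A.R x ^ k) x} ⊔ A.lcs (k + 1) ≤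
      A.L0 ⊔ A.lcs (k + 1)) (key k ha)
    refine le_trans ?_ le_sup_left
    rw [Submodule.span_singleton_le_iff_mem]
    exact A.Rpow_even hx hx k) y Submodule.mem_top Submodule.mem_top
  exact hy0 (Submodule.disjoint_def.1 A.compl.disjoint y h hy)

/-- The case `x ∈ L²`. -/
theorem x_notin [FiniteDimensional ℂ V] (hnil : A.IsNilpotent) {x y : V} (hy : y ∈ A.L1)
    (hgen : A.Generates {x, y}) {n : ℕ} (hn : Module.finrank ℂ A.L0 = n) (hn3 : 3 ≤ n)
    (hchar0 : ∀ x ∈ A.L0, x ∉ A.lcs0 1 → ∀ z ∈ A.L0, ((A.R x) ^ (n - 2)) z = 0) :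
    x ∉ A.lcs 1 := by
  intro hx1
  have key : ∀ k, A.lcs k ≤ Submodule.span ℂ {(A.R y ^ k) y} ⊔ A.lcs (k + 1) := by
    intro k
    induction k with
    | zero =>
      show ⊤ ≤ _
      rw [← A.gen_top hgen]
      refine sup_le (Submodule.span_le.2 ?_) le_sup_right
      rintro a (rfl | rfl)
      · exact Submodule.mem_sup_right hx1
      · exact Submodule.mem_sup_left (Submodule.subset_span (by simp))
    | succ k ih =>
      refine A.gen_step hgen _ _ ih le_sup_right ?_ ?_
      · rintro a rfl
        refine Submodule.mem_sup_right ?_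
        exact A.br_mem' (i := k) (j := 1) (by omega)
          (by simpa using A.Rpow_mem y y (i := 0) Submodule.mem_top k) hx1
      · rintro a rfl
        exact Submodule.mem_sup_left (Submodule.subset_span (by simp [Rpow_succ]))
  have hL0 : A.L0 ≤ A.lcs 1 := by
    intro a ha
    refine A.even_mem hy ha ?_
    have := key 0 (show a ∈ A.lcs 0 from Submodule.mem_top)
    simpa using this
  set v := A.br y y with hv
  have hv0 : v ∈ A.L0 := A.grade11 _ hy _ hy
  have hTv : ∀ j, (A.R v ^ j) v = (2 : ℂ) ^ j • (A.R y ^ (2 * j)) v := by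
    intro j
    induction j with
    | zero => simp
    | succ j ih =>
      rw [Rpow_succ, ih, hv, map_smul, LinearMap.smul_apply, A.br_sq hy, ← hv, smul_smul,
        show 2 * (j + 1) = 2 * j + 1 + 1 by ring, Rpow_succ, Rpow_succ, pow_succ]
  have hyv : ∀ k, (A.R y ^ (k + 1)) y = (A.R y ^ k) v := by
    intro k
    rw [pow_succ, Module.End.mul_apply, R_apply]
  set W := Submodule.span ℂ (Set.range fun j : ℕ => (A.R v ^ j) v) with hW
  have hWL : W ≤ A.L0 := by
    refine Submodule.span_le.2 ?_
    rintro _ ⟨j, rfl⟩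
    exact A.Rpow_even hv0 hv0 j
  have hmem : ∀ a ∈ A.lcs 1, a ∈ A.L0 → a ∈ W := by
    refine A.descend hnil _ _ hWL 1 ?_
    intro k hk a ha ha0
    obtain ⟨k, rfl⟩ := Nat.exists_eq_add_of_le' hk
    have hk' := key (k + 1) ha
    rw [hyv] at hk'
    rcases Nat.even_or_odd' k with ⟨j, rfl | rfl⟩
    · refine (sup_le ?_ le_sup_right : _ ≤ W ⊔ A.lcs (2 * j + 1 + 1)) hk'
      refine le_trans ?_ le_sup_left
      rw [Submodule.span_singleton_le_iff_mem]
      have h1 : (A.R v ^ j) v ∈ W := Submodule.subset_span ⟨j, rfl⟩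
      rw [hTv] at h1
      exact (Submodule.smul_mem_iff _ (pow_ne_zero _ two_ne_zero)).1 h1
    · exact Submodule.mem_sup_right (A.even_mem (A.Rpow_parity hy hv0 j).2 ha0 hk')
  have hvn : v ∉ A.lcs0 1 := by
    intro h
    have h3 : v ∈ A.lcs 2 := A.lcs_anti (by norm_num) (A.lcs0_one_le hL0 h)
    have hbot : ∀ a ∈ A.lcs 1, a ∈ (⊤ : Submodule ℂ V) → a ∈ (⊥ : Submodule ℂ V) := by
      have hle : ∀ d, A.lcs 1 ≤ A.lcs (d + 1) := by
        intro d
        induction d with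
        | zero => exact le_rfl
        | succ d ih =>
          have hd : (A.R y ^ d) v ∈ A.lcs (d + 2) := by
            have := A.Rpow_mem y v h3 d
            rwa [add_comm] at this
          refine ih.trans ((key (d + 1)).trans (sup_le ?_ le_rfl))
          rw [hyv, Submodule.span_singleton_le_iff_mem]
          exact hd
      intro a ha _
      obtain ⟨s, hs⟩ := hnil
      rw [← hs]
      exact A.lcs_succ_le s (hle s ha)
    have : A.L0 = ⊥ := by
      rw [eq_bot_iff]
      intro a ha
      exact hbot a (hL0 ha) trivial
    rw [this, finrank_bot] at hn
    omega
  have := finrank_orbit A.L0 0 v (A.R v) (n - 2) (hchar0 v hv0 hvn v hv0)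
    (fun a ha => Submodule.mem_sup_right (hmem a (hL0 ha) ha))
  omega

/-- One-dimensionality of the successive quotients. -/
theorem one_dim [FiniteDimensional ℂ V] (hnil : A.IsNilpotent) {N : ℕ} (hN : A.lcs N ≠ ⊥)
    (h1 : Module.finrank ℂ (A.lcs 1) ≤ N) {k : ℕ} (hk : 1 ≤ k) {a : V} (ha : a ∈ A.lcs k)
    (ha' : a ∉ A.lcs (k + 1)) : A.lcs k ≤ Submodule.span ℂ {a} ⊔ A.lcs (k + 1) := by
  have stab : ∀ k, A.lcs (k + 1) = A.lcs k → A.lcs k = ⊥ := by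
    intro k h
    have : ∀ d, A.lcs (k + d) = A.lcs k := by
      intro d
      induction d with
      | zero => rfl
      | succ d ih =>
        show A.prodSpan (A.lcs (k + d)) ⊤ = _
        rw [ih]; exact h
    obtain ⟨s, hs⟩ := hnil
    rw [eq_bot_iff, ← hs, ← this s]
    exact A.lcs_anti (by omega)
  have strict : ∀ k, A.lcs k ≠ ⊥ →
      Module.finrank ℂ (A.lcs (k + 1)) + 1 ≤ Module.finrank ℂ (A.lcs k) := by
    intro k hk
    refine Submodule.finrank_lt_finrank_of_lt (lt_of_le_of_ne (A.lcs_succ_le k) ?_)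
    exact fun h => hk (stab k h)
  have up : ∀ k, Module.finrank ℂ (A.lcs (k + 1)) ≤ N - k := by
    intro k
    induction k with
    | zero => simpa using h1
    | succ k ih =>
      by_cases hb : A.lcs (k + 1) = ⊥
      · have : A.lcs (k + 1 + 1) = ⊥ := by
          rw [eq_bot_iff, ← hb]; exact A.lcs_succ_le _
        rw [this, finrank_bot]; omega
      · have := strict _ hb
        omega
  have down : ∀ d k, k + d = N → d + 1 ≤ Module.finrank ℂ (A.lcs k) := by
    intro d
    induction d with
    | zero =>
      rintro k rfl
      have : 0 < Module.finrank ℂ (A.lcs k) := by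
        rw [Nat.pos_iff_ne_zero]
        intro h
        exact hN (Submodule.finrank_eq_zero.1 h)
      omega
    | succ d ih =>
      intro k hk
      have h2 := ih (k + 1) (by omega)
      have := strict k (by
        intro h
        have h3 : A.lcs (k + 1) = ⊥ := by
          rw [eq_bot_iff, ← h]; exact A.lcs_succ_le _
        rw [h3, finrank_bot] at h2
        omega)
      omega
  have hlt : A.lcs (k + 1) < Submodule.span ℂ {a} ⊔ A.lcs (k + 1) := by
    refine lt_of_le_of_ne le_sup_right ?_
    intro h
    apply ha'
    rw [h]
    exact Submodule.mem_sup_left (Submodule.mem_span_singleton_self a)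
  have hle : Submodule.span ℂ {a} ⊔ A.lcs (k + 1) ≤ A.lcs k :=
    sup_le ((Submodule.span_singleton_le_iff_mem _ _).2 ha) (A.lcs_succ_le k)
  have hfl := Submodule.finrank_lt_finrank_of_lt hlt
  obtain ⟨k, rfl⟩ := Nat.exists_eq_add_of_le' hk
  have hup := up k
  refine (Submodule.eq_of_le_of_finrank_le hle ?_).ge
  by_cases hkN : k + 2 ≤ N
  · have := down (N - (k + 2)) (k + 2) (by omega)
    have e : k + 1 + 1 = k + 2 := rfl
    rw [e] at hfl ⊢
    omega
  · omega

/-- The case `[y,x] ∉ L³`. -/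
theorem case_C [FiniteDimensional ℂ V] (hnil : A.IsNilpotent) {x y : V} (hx : x ∈ A.L0)
    (hy : y ∈ A.L1)
    (hgen : A.Generates {x, y}) (hn3 : 3 ≤ Module.finrank ℂ A.L0)
    (hdim : ∀ k, 1 ≤ k → ∀ a ∈ A.lcs k, a ∉ A.lcs (k + 1) →
      A.lcs k ≤ Submodule.span ℂ {a} ⊔ A.lcs (k + 1))
    (hY : A.br y x ∉ A.lcs 2) : False := by
  classical
  set Y : ℕ → V := fun j => (A.R x ^ j) y with hYd
  have Y0 : Y 0 = y := by simp [hYd]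
  have Ys : ∀ j, Y (j + 1) = A.br (Y j) x := fun j => A.Rpow_succ x y j
  have Ymem : ∀ j, Y j ∈ A.lcs j := fun j => by
    simpa using A.Rpow_mem x y (i := 0) Submodule.mem_top j
  have Yodd : ∀ j, Y j ∈ A.L1 := fun j => A.Rpow_odd hx hy j
  have hex : ∃ t, 1 ≤ t ∧ Y t ∈ A.lcs (t + 1) := by
    obtain ⟨s, hs⟩ := hnil
    refine ⟨s + 1, by omega, ?_⟩
    have : Y (s + 1) ∈ A.lcs s := A.lcs_succ_le s (Ymem _)
    rw [hs, Submodule.mem_bot] at this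
    rw [this]; exact Submodule.zero_mem _
  obtain ⟨t, ⟨ht1, htY⟩, hmin⟩ : ∃ t, (1 ≤ t ∧ Y t ∈ A.lcs (t + 1)) ∧
      ∀ k < t, ¬ (1 ≤ k ∧ Y k ∈ A.lcs (k + 1)) :=
    ⟨Nat.find hex, Nat.find_spec hex, fun k hk => Nat.find_min hex hk⟩
  have ht2 : 2 ≤ t := by
    by_contra h
    have : t = 1 := by omega
    subst this
    rw [Ys, Y0] at htY
    exact hY htY
  have hF : ∀ k, 1 ≤ k → k < t → A.lcs k ≤ Submodule.span ℂ {Y k} ⊔ A.lcs (k + 1) := by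
    intro k hk hkt
    exact hdim k hk _ (Ymem k) (fun h => hmin k hkt ⟨hk, h⟩)
  have heven : ∀ d, d + 1 ≤ t → ∀ a ∈ A.lcs 1, a ∈ A.L0 → a ∈ A.lcs (d + 1) := by
    intro d
    induction d with
    | zero => intro _ a ha _; exact ha
    | succ d ih =>
      intro hd a ha ha0
      exact A.even_mem (Yodd (d + 1)) ha0 (hF (d + 1) (by omega) (by omega) (ih (by omega) a ha ha0))
  have heven' : ∀ a ∈ A.lcs 1, a ∈ A.L0 → a ∈ A.lcs t := by
    have := heven (t - 1) (by omega)
    rwa [Nat.sub_add_cancel ht1] at this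
  have hYY : ∀ i j, A.br (Y i) (Y j) ∈ A.lcs t := fun i j =>
    heven' _ (A.br_mem_lcs_succ (k := 0) Submodule.mem_top _) (A.grade11 _ (Yodd i) _ (Yodd j))
  have hrec : ∀ i j, A.br (Y (i + 1)) (Y j) = A.br (A.br (Y i) (Y j)) x - A.br (Y i) (Y (j + 1)) := by
    intro i j
    rw [Ys j, A.super_oe _ _ (Yodd j) _ hx, Ys i]
    abel
  set z0 := A.br (Y 0) (Y (t - 1)) with hz0
  have hz : ∀ i j, i + j + 1 = t → A.br (Y i) (Y j) - (-1 : ℂ) ^ i • z0 ∈ A.lcs (t + 1) := by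
    intro i
    induction i with
    | zero =>
      intro j hj
      have : j = t - 1 := by omega
      subst this
      simp [hz0]
    | succ i ih =>
      intro j hj
      have h1 := ih (j + 1) (by omega)
      have h2 := A.br_mem_lcs_succ (hYY i j) x
      rw [hrec]
      have := Submodule.sub_mem _ h2 h1
      convert this using 1
      rw [pow_succ]
      module
  set c := A.br z0 x with hc
  have hb : ∀ i j, i + j = t →
      A.br (Y i) (Y j) + ((-1 : ℂ) ^ i * (i : ℂ)) • c ∈ A.lcs (t + 2) := by
    intro i
    induction i with
    | zero =>
      intro j hj
      have : j = t := by omega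
      subst this
      simp only [Nat.cast_zero, mul_zero, zero_smul, add_zero]
      exact A.br_mem' (by omega) (Ymem 0) htY
    | succ i ih =>
      intro j hj
      have h1 := ih (j + 1) (by omega)
      have h2 := A.br_mem_lcs_succ (hz i j (by omega)) x
      rw [hrec]
      have := Submodule.sub_mem _ h2 h1
      convert this using 1
      rw [map_sub, map_smul, LinearMap.sub_apply, LinearMap.smul_apply, ← hc, pow_succ]
      push_cast
      module
  have hcm : c ∈ A.lcs (t + 2) := by
    have h1 := hb t 0 (by omega)
    have h2 : A.br (Y t) (Y 0) ∈ A.lcs (t + 2) := A.br_mem_lcs_succ htY _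
    have h3 := (Submodule.add_mem_iff_right _ h2).1 h1
    refine (Submodule.smul_mem_iff _ ?_).1 h3
    refine mul_ne_zero (pow_ne_zero _ (by norm_num)) ?_
    exact_mod_cast (by omega : t ≠ 0)
  set z := A.br (Y (t - 1)) (Y 0) with hzd
  have hzx : A.br z x ∈ A.lcs (t + 2) := by
    have h1 := A.br_mem_lcs_succ (hz (t - 1) 0 (by omega)) x
    rw [map_sub, map_smul, LinearMap.sub_apply, LinearMap.smul_apply, ← hc, ← hzd] at h1
    have := Submodule.add_mem _ h1 (Submodule.smul_mem _ ((-1 : ℂ) ^ (t - 1)) hcm)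
    simpa using this
  have hzy : A.br z y ∈ A.lcs (t + 2) := by
    have h1 : A.br (Y (t - 1)) (A.br y y) ∈ A.lcs (t + 2) := by
      refine A.br_mem' (i := t - 1) (j := t) (by omega) (Ymem _) ?_
      have := hYY 0 0
      rwa [Y0] at this
    rw [A.br_sq hy] at h1
    have := (Submodule.smul_mem_iff _ (two_ne_zero)).1 h1
    rw [hzd, Y0]
    exact this
  obtain ⟨r, rfl⟩ : ∃ r, t = r + 1 := ⟨t - 1, by omega⟩
  have hFt : A.lcs (r + 1) ≤ Submodule.span ℂ {z} ⊔ A.lcs (r + 2) := by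
    refine A.gen_step hgen _ _ (hF r (by omega) (by omega)) le_sup_right ?_ ?_
    · rintro a rfl
      refine Submodule.mem_sup_right ?_
      rw [← Ys]; exact htY
    · rintro a rfl
      refine Submodule.mem_sup_left ?_
      have : A.br (Y r) y = z := by simp [hzd, Y0]
      rw [this]; exact Submodule.mem_span_singleton_self z
  have hFt1 : A.lcs (r + 2) ≤ A.lcs (r + 3) := by
    refine A.gen_step hgen _ _ hFt le_rfl ?_ ?_
    · rintro a rfl; exact hzx
    · rintro a rfl; exact hzy
  have hle : ∀ d, A.lcs (r + 2) ≤ A.lcs (r + 2 + d) := by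
    intro d
    induction d with
    | zero => exact le_rfl
    | succ d ih =>
      refine hFt1.trans ?_
      refine Submodule.span_le.2 ?_
      rintro w ⟨u, hu, v, -, rfl⟩
      exact A.br_mem_lcs_succ (ih hu) v
  have hbot : A.lcs (r + 2) = ⊥ := by
    obtain ⟨s, hs⟩ := hnil
    rw [eq_bot_iff, ← hs]
    exact (hle s).trans (A.lcs_anti (by omega))
  rw [hbot, sup_bot_eq] at hFt
  have hL0 : A.L0 ≤ Submodule.span ℂ {x} ⊔
      Submodule.span ℂ (Set.range fun j : ℕ => ((0 : V →ₗ[ℂ] V) ^ j) z) := by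
    intro a ha
    have h1 : a ∈ Submodule.span ℂ {y} ⊔ (Submodule.span ℂ {x} ⊔ A.lcs 1) := by
      rw [← sup_assoc, ← Submodule.span_union, Set.union_singleton, A.gen_top hgen]
      trivial
    obtain ⟨P, h0, h1', h2, h3, hP⟩ := A.exists_proj
    obtain ⟨u, hu, b, hb, rfl⟩ := Submodule.mem_sup.1 h1
    obtain ⟨q, hq, f, hf, rfl⟩ := Submodule.mem_sup.1 hb
    obtain ⟨α, rfl⟩ := Submodule.mem_span_singleton.1 hu
    obtain ⟨β, rfl⟩ := Submodule.mem_span_singleton.1 hq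
    rw [← h2 _ ha, map_add, map_add, map_smul, map_smul, h3 _ hy, h2 _ hx, smul_zero, zero_add]
    refine Submodule.add_mem _ (Submodule.mem_sup_left hq) (Submodule.mem_sup_right ?_)
    have := hFt (heven' _ (hP _ _ hf) (h0 _))
    refine (Submodule.span_mono ?_) this
    rintro _ rfl
    exact ⟨0, by simp⟩
  have := finrank_orbit A.L0 x z 0 1 (by simp) hL0
  omega

/-- The case `[y,x] ∈ L³`. -/
theorem case_B [FiniteDimensional ℂ V] (hnil : A.IsNilpotent) {x y : V} (hx : x ∈ A.L0)
    (hy : y ∈ A.L1) (hgen : A.Generates {x, y})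
    (hspan : A.L1 ≤ Submodule.span ℂ (Set.range fun j : ℕ => (A.R x ^ j) y))
    {n : ℕ} (hn : Module.finrank ℂ A.L0 = n) (hn3 : 3 ≤ n)
    (hchar0 : ∀ x ∈ A.L0, x ∉ A.lcs0 1 → ∀ z ∈ A.L0, ((A.R x) ^ (n - 2)) z = 0)
    (hx1 : x ∉ A.lcs 1) (hy1 : y ∉ A.lcs 1) (hF12 : ¬ A.lcs 1 ≤ A.lcs 2)
    (hdim : ∀ k, 1 ≤ k → ∀ a ∈ A.lcs k, a ∉ A.lcs (k + 1) →
      A.lcs k ≤ Submodule.span ℂ {a} ⊔ A.lcs (k + 1))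
    (hY : A.br y x ∈ A.lcs 2) : False := by
  obtain ⟨P, h0, h1, h2, h3, hP⟩ := A.exists_proj
  have hL1 : ∀ a ∈ A.lcs 1, a ∈ A.L1 → a ∈ A.lcs 2 := by
    intro a ha ha1
    have hle : Submodule.span ℂ (Set.range fun j : ℕ => (A.R x ^ j) y) ≤
        Submodule.span ℂ {y} ⊔ A.lcs 2 := by
      refine Submodule.span_le.2 ?_
      rintro _ ⟨j, rfl⟩
      cases j with
      | zero => exact Submodule.mem_sup_left (Submodule.subset_span (by simp))
      | succ j =>
        refine Submodule.mem_sup_right ?_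
        have := A.Rpow_mem x _ hY j
        simp only [pow_succ, Module.End.mul_apply, R_apply]
        exact A.lcs_anti (by omega) this
    obtain ⟨u, hu, b, hb, rfl⟩ := Submodule.mem_sup.1 (hle (hspan ha1))
    obtain ⟨c, rfl⟩ := Submodule.mem_span_singleton.1 hu
    have hcy : c • y ∈ A.lcs 1 :=
      (Submodule.add_mem_iff_left _ (A.lcs_succ_le 1 hb)).1 ha
    by_cases hc : c = 0
    · simpa [hc] using hb
    · exact absurd ((Submodule.smul_mem_iff _ hc).1 hcy) hy1
  set v := A.br y y with hv
  have hv0 : v ∈ A.L0 := A.grade11 _ hy _ hy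
  have hv1 : v ∈ A.lcs 1 := A.br_mem_lcs_succ (k := 0) Submodule.mem_top _
  -- choice of the generator `e`
  obtain ⟨e, he0, he1, he2, hRe⟩ : ∃ e, e ∈ A.L0 ∧ e ∈ A.lcs 1 ∧ e ∉ A.lcs 2 ∧
      ∀ a, A.br a (A.br e y) = 0 := by
    by_cases hxx : A.br x x ∈ A.lcs 2
    · refine ⟨v, hv0, hv1, ?_, ?_⟩
      · intro hv2
        apply hF12
        refine A.gen_step hgen (k := 0) {x, y} _ (by rw [A.gen_top hgen]; exact le_top) le_rfl ?_ ?_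
        · rintro a (rfl | rfl)
          · exact hxx
          · exact hY
        · rintro a (rfl | rfl)
          · exact hL1 _ (A.br_mem_lcs_succ (k := 0) Submodule.mem_top _) (A.grade01 _ hx _ hy)
          · exact hv2
      · intro a
        rw [A.super_eo a v hv0 y hy, hv, A.br_sq hy, A.br_sq hy, map_smul, LinearMap.smul_apply,
          sub_self]
    · refine ⟨A.br x x, A.grade00 _ hx _ hx, A.br_mem_lcs_succ (k := 0) Submodule.mem_top _, hxx, ?_⟩
      intro a
      rw [A.super_eo a _ (A.grade00 _ hx _ hx) y hy, A.br_sq_even hx, A.br_sq_even hx, map_zero,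
        LinearMap.zero_apply, sub_self]
  have hF1 := hdim 1 le_rfl e he1 he2
  have hcomm : ∀ a, A.br (A.br a y) x = A.br (A.br a x) y + A.br a (A.br y x) := by
    intro a
    rw [A.super_oe a y hy x hx]; abel
  have hL0x : ∀ W : Submodule ℂ V, (∀ a ∈ A.lcs 1, a ∈ A.L0 → a ∈ W) →
      A.L0 ≤ Submodule.span ℂ {x} ⊔ W := by
    intro W hW a ha
    have h1 : a ∈ Submodule.span ℂ {y} ⊔ (Submodule.span ℂ {x} ⊔ A.lcs 1) := by
      rw [← sup_assoc, ← Submodule.span_union, Set.union_singleton, A.gen_top hgen]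
      trivial
    obtain ⟨u, hu, b, hb, rfl⟩ := Submodule.mem_sup.1 h1
    obtain ⟨q, hq, f, hf, rfl⟩ := Submodule.mem_sup.1 hb
    obtain ⟨α, rfl⟩ := Submodule.mem_span_singleton.1 hu
    obtain ⟨β, rfl⟩ := Submodule.mem_span_singleton.1 hq
    rw [← h2 _ ha, map_add, map_add, map_smul, map_smul, h3 _ hy, h2 _ hx, smul_zero, zero_add]
    exact Submodule.add_mem _ (Submodule.mem_sup_left hq)
      (Submodule.mem_sup_right (hW _ (hP _ _ hf) (h0 _)))
  have hlcs01 : A.lcs0 1 ≤ A.lcs 1 := A.lcs0_one_le (k := 0) le_top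
  by_cases hey : A.br e y ∈ A.lcs 3
  · -- the case of powers of `R_x`
    have key : ∀ k, A.lcs (k + 1) ≤ Submodule.span ℂ {(A.R x ^ k) e} ⊔ A.lcs (k + 2) ∧
        A.br ((A.R x ^ k) e) y ∈ A.lcs (k + 3) := by
      intro k
      induction k with
      | zero => exact ⟨by simpa using hF1, by simpa using hey⟩
      | succ k ih =>
        constructor
        · refine A.gen_step hgen _ _ ih.1 le_sup_right ?_ ?_
          · rintro a rfl
            rw [← Rpow_succ]
            exact Submodule.mem_sup_left (Submodule.mem_span_singleton_self _)
          · rintro a rfl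
            exact Submodule.mem_sup_right ih.2
        · have hc := hcomm ((A.R x ^ k) e)
          rw [← Rpow_succ] at hc
          rw [← sub_eq_iff_eq_add] at hc
          rw [← hc]
          refine Submodule.sub_mem _ (A.br_mem_lcs_succ ih.2 x) ?_
          exact A.br_mem' (i := 1 + k) (j := 2) (by omega) (A.Rpow_mem x e he1 k) hY
    set W := Submodule.span ℂ (Set.range fun j : ℕ => (A.R x ^ j) e) with hW
    have hWL : W ≤ A.L0 := by
      refine Submodule.span_le.2 ?_
      rintro _ ⟨j, rfl⟩
      exact A.Rpow_even hx he0 j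
    have hmem : ∀ a ∈ A.lcs 1, a ∈ A.L0 → a ∈ W := by
      refine A.descend hnil _ _ hWL 1 ?_
      intro k hk a ha ha0
      obtain ⟨k, rfl⟩ := Nat.exists_eq_add_of_le' hk
      refine (sup_le ?_ le_sup_right : _ ≤ W ⊔ A.lcs (k + 2)) ((key k).1 ha)
      refine le_trans ?_ le_sup_left
      rw [Submodule.span_singleton_le_iff_mem]
      exact Submodule.subset_span ⟨k, rfl⟩
    have := finrank_orbit A.L0 x e (A.R x) (n - 2)
      (hchar0 x hx (fun h => hx1 (hlcs01 h)) e he0) (hL0x W hmem)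
    omega
  · -- the case of powers of `R_y`
    have hey2 : A.br e y ∈ A.lcs 2 := A.br_mem_lcs_succ he1 y
    have hey1 : A.br e y ∈ A.L1 := A.grade01 _ he0 _ hy
    have hF2 := hdim 2 (by norm_num) _ hey2 hey
    have hex3 : A.br e x ∈ A.lcs 3 :=
      A.even_mem hey1 (A.grade00 _ he0 _ hx) (hF2 (A.br_mem_lcs_succ he1 x))
    -- right multiplication by `[y,x]` raises the degree by four
    have hYk : ∀ k, ∀ a ∈ A.lcs k, A.br a (A.br y x) ∈ A.lcs (k + 4) := by
      intro k a ha
      obtain ⟨u, hu, f, hf, hsum⟩ := Submodule.mem_sup.1 (hF2 hY)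
      obtain ⟨μ, rfl⟩ := Submodule.mem_span_singleton.1 hu
      rw [← hsum, map_add, map_smul, hRe, smul_zero, zero_add]
      exact A.br_mem' (by omega) ha hf
    set E : ℕ → V := fun k => (A.R y ^ k) e with hE
    have E0 : E 0 = e := by simp [hE]
    have Es : ∀ k, E (k + 1) = A.br (E k) y := fun k => A.Rpow_succ y e k
    have Emem : ∀ k, E k ∈ A.lcs (k + 1) := fun k => by
      rw [add_comm]; exact A.Rpow_mem y e he1 k
    have key : ∀ k, A.lcs (k + 1) ≤ Submodule.span ℂ {E k} ⊔ A.lcs (k + 2) ∧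
        A.br (E k) x ∈ A.lcs (k + 3) := by
      intro k
      induction k with
      | zero => rw [E0]; exact ⟨hF1, hex3⟩
      | succ k ih =>
        constructor
        · refine A.gen_step hgen _ _ ih.1 le_sup_right ?_ ?_
          · rintro a rfl
            exact Submodule.mem_sup_right ih.2
          · rintro a rfl
            rw [← Es]
            exact Submodule.mem_sup_left (Submodule.mem_span_singleton_self _)
        · rw [Es, hcomm]
          exact Submodule.add_mem _ (A.br_mem_lcs_succ ih.2 y)
            (A.lcs_anti (by omega) (hYk _ _ (Emem k)))
    obtain ⟨l, hl⟩ : ∃ l : ℂ, A.br e x - l • E 2 ∈ A.lcs 4 := by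
      obtain ⟨u, hu, f, hf, hsum⟩ := Submodule.mem_sup.1 ((key 2).1 hex3)
      obtain ⟨l, rfl⟩ := Submodule.mem_span_singleton.1 hu
      refine ⟨l, ?_⟩
      rw [← hsum]
      simpa using hf
    have hlam : ∀ k, A.br (E k) x - l • E (k + 2) ∈ A.lcs (k + 4) := by
      intro k
      induction k with
      | zero => rw [E0]; exact hl
      | succ k ih =>
        rw [Es k, hcomm, Es (k + 2)]
        have h5 := A.br_mem_lcs_succ ih y
        have h6 := hYk _ _ (Emem k)
        have := Submodule.add_mem _ h5 (A.lcs_anti (by omega : k + 4 + 1 ≤ k + 1 + 4) h6)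
        convert this using 1
        rw [map_sub, map_smul, LinearMap.sub_apply, LinearMap.smul_apply]
        abel
    set w := x + ((1 - l) / 2) • v with hw
    have hw0 : w ∈ A.L0 := A.L0.add_mem hx (A.L0.smul_mem _ hv0)
    have hwn : w ∉ A.lcs0 1 := by
      intro h
      exact hx1 ((Submodule.add_mem_iff_left _ (Submodule.smul_mem _ _ hv1)).1 (hlcs01 h))
    have hbw : ∀ a, A.br a w = A.br a x + (1 - l) • A.br (A.br a y) y := by
      intro a
      rw [hw, map_add, map_smul, hv, A.br_sq hy, smul_smul]
      congr 2
      ring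
    have hTE : ∀ k, A.br (E k) w - E (k + 2) ∈ A.lcs (k + 4) := by
      intro k
      rw [hbw, ← Es, ← Es]
      convert hlam k using 1
      module
    have hTF : ∀ k, ∀ a ∈ A.lcs (k + 1), A.br a w ∈ A.lcs (k + 3) := by
      intro k a ha
      rw [hbw]
      refine Submodule.add_mem _ ?_ (Submodule.smul_mem _ _
        (A.br_mem_lcs_succ (A.br_mem_lcs_succ ha y) y))
      obtain ⟨u, hu, f, hf, rfl⟩ := Submodule.mem_sup.1 ((key k).1 ha)
      obtain ⟨μ, rfl⟩ := Submodule.mem_span_singleton.1 hu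
      rw [map_add, map_smul, LinearMap.add_apply, LinearMap.smul_apply]
      exact Submodule.add_mem _ (Submodule.smul_mem _ _ (key k).2) (A.br_mem_lcs_succ hf x)
    have hTj : ∀ j, (A.R w ^ j) e - E (2 * j) ∈ A.lcs (2 * j + 2) := by
      intro j
      induction j with
      | zero => simp [E0]
      | succ j ih =>
        have h5 := hTF (2 * j + 1) _ ih
        have h6 := hTE (2 * j)
        have := Submodule.add_mem _ h5 h6
        rw [Rpow_succ]
        rw [show 2 * (j + 1) + 2 = 2 * j + 1 + 3 by ring]
        convert this using 1
        rw [map_sub, LinearMap.sub_apply, show 2 * (j + 1) = 2 * j + 2 by ring]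
        abel
    set W := Submodule.span ℂ (Set.range fun j : ℕ => (A.R w ^ j) e) with hW
    have hWL : W ≤ A.L0 := by
      refine Submodule.span_le.2 ?_
      rintro _ ⟨j, rfl⟩
      exact A.Rpow_even hw0 he0 j
    have hmem : ∀ a ∈ A.lcs 1, a ∈ A.L0 → a ∈ W := by
      refine A.descend hnil _ _ hWL 1 ?_
      intro k hk a ha ha0
      obtain ⟨k, rfl⟩ := Nat.exists_eq_add_of_le' hk
      have hk' := (key k).1 ha
      rcases Nat.even_or_odd' k with ⟨j, rfl | rfl⟩
      · refine (sup_le ?_ le_sup_right : _ ≤ W ⊔ A.lcs (2 * j + 2)) hk'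
        rw [Submodule.span_singleton_le_iff_mem]
        have h5 : (A.R w ^ j) e ∈ W := Submodule.subset_span ⟨j, rfl⟩
        have := Submodule.sub_mem _ (Submodule.mem_sup_left (T := A.lcs (2 * j + 2)) h5)
          (Submodule.mem_sup_right (hTj j))
        simpa using this
      · exact Submodule.mem_sup_right (A.even_mem (A.Rpow_parity hy he0 j).2 ha0 hk')
    have := finrank_orbit A.L0 x e (A.R w) (n - 2) (hchar0 w hw0 hwn e he0) (hL0x W hmem)
    omega

end Aux

end LeibnizSuperAlg

/-- A nilpotent complex Leibniz superalgebra with `dim L₀ = n ≥ 3`,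
`dim L₁ = m`, generated by `x₁ ∈ L₀` and `y₁ ∈ L₁` with an adapted basis
`y₁,…,y_m` of `L₁`, such that `(R_x|L₀)^{n−2} = 0` for every `x ∈ L₀ \ L₀²`
and `dim L₀³ = n − 3`, has nilindex less than `n + m`, i.e. `L^{n+m−1} = 0`. -/
theorem statement3 {V : Type*} [AddCommGroup V] [Module ℂ V] [FiniteDimensional ℂ V]
    (A : LeibnizSuperAlg V) (n m : ℕ)
    (hn : Module.finrank ℂ A.L0 = n) (hm : Module.finrank ℂ A.L1 = m)
    (hn3 : 3 ≤ n) (hm1 : 1 ≤ m)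
    (hnil : A.IsNilpotent)
    (x₁ : V) (hx₁ : x₁ ∈ A.L0)
    (y : Fin m → V) (hyL1 : ∀ i, y i ∈ A.L1)
    (hyind : LinearIndependent ℂ y)
    (hyspan : Submodule.span ℂ (Set.range y) = A.L1)
    (hgen : A.Generates {x₁, y ⟨0, by omega⟩})
    (hrel : ∀ i : ℕ, ∀ h : i + 1 < m, A.br (y ⟨i, by omega⟩) x₁ = y ⟨i + 1, h⟩)
    (hlast : A.br (y ⟨m - 1, by omega⟩) x₁ = 0)
    (hchar0 : ∀ x ∈ A.L0, x ∉ A.lcs0 1 → ∀ z ∈ A.L0, ((A.R x) ^ (n - 2)) z = 0)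
    (hdim : Module.finrank ℂ (A.lcs0 2) = n - 3) :
    A.lcs (n + m - 2) = ⊥ := by
  by_contra hN
  set y0 := y ⟨0, by omega⟩ with hy0d
  have hy0 : y0 ∈ A.L1 := hyL1 _
  have hy0ne : y0 ≠ 0 := hyind.ne_zero _
  have hy1 : y0 ∉ A.lcs 1 := A.y_notin hnil hx₁ hy0 hy0ne hgen
  have hx1 : x₁ ∉ A.lcs 1 := A.x_notin hnil hy0 hgen hn hn3 hchar0
  have hyp : ∀ i : ℕ, ∀ h : i < m, y ⟨i, h⟩ = (A.R x₁ ^ i) y0 := by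
    intro i
    induction i with
    | zero => intro h; simp [hy0d]
    | succ i ih =>
      intro h
      rw [A.Rpow_succ, ← ih (by omega), hrel i h]
  have hspan : A.L1 ≤ Submodule.span ℂ (Set.range fun j : ℕ => (A.R x₁ ^ j) y0) := by
    rw [← hyspan]
    refine Submodule.span_mono ?_
    rintro _ ⟨⟨i, hi⟩, rfl⟩
    exact ⟨i, (hyp i hi).symm⟩
  have hV : Module.finrank ℂ V = n + m := by
    rw [← hn, ← hm]
    exact (Submodule.finrank_add_eq_of_isCompl A.compl).symm
  have hF1 : Module.finrank ℂ (A.lcs 1) ≤ n + m - 2 := by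
    have l1 : A.lcs 1 < Submodule.span ℂ {x₁} ⊔ A.lcs 1 := by
      refine lt_of_le_of_ne le_sup_right ?_
      intro h
      apply hx1
      rw [h]
      exact Submodule.mem_sup_left (Submodule.mem_span_singleton_self _)
    have l2 : Submodule.span ℂ {x₁} ⊔ A.lcs 1 < ⊤ := by
      rw [lt_top_iff_ne_top]
      intro h
      exact hy1 (A.odd_mem hx₁ hy0 (by rw [h]; trivial))
    have f1 := Submodule.finrank_lt_finrank_of_lt l1
    have f2 := Submodule.finrank_lt l2.ne
    omega
  have hdim' : ∀ k, 1 ≤ k → ∀ a ∈ A.lcs k, a ∉ A.lcs (k + 1) →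
      A.lcs k ≤ Submodule.span ℂ {a} ⊔ A.lcs (k + 1) :=
    fun k hk a ha ha' => A.one_dim hnil hN hF1 hk ha ha'
  by_cases hY : A.br y0 x₁ ∈ A.lcs 2
  · refine A.case_B hnil hx₁ hy0 hgen hspan hn hn3 hchar0 hx1 hy1 ?_ hdim' hY
    intro hle
    have hle' : ∀ d, A.lcs 1 ≤ A.lcs (1 + d) := by
      intro d
      induction d with
      | zero => exact le_rfl
      | succ d ih =>
        refine hle.trans ?_
        refine Submodule.span_le.2 ?_
        rintro w ⟨u, hu, v, -, rfl⟩
        exact A.br_mem_lcs_succ (ih hu) v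
    apply hN
    obtain ⟨s, hs⟩ := hnil
    rw [eq_bot_iff, ← hs]
    exact (A.lcs_anti (by omega : 1 ≤ n + m - 2)).trans ((hle' s).trans (A.lcs_anti (by omega)))
  · exact A.case_C hnil hx₁ hy0 hgen (by omega) hdim' hY
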